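/- Let L be a distributive lattice, let a ∈ L, let c be a connected component of a, and suppose a = a₁ ⊔ ⋯ ⊔ aₙ for elements a₁, …, aₙ ∈ L (n ≥ 1). Then c is a connected component of some aᵢ. -/

import Mathlib

open Set

/-- `upSet M = {x | ∃ m ∈ M, m ≤ x}`. -/
def upSet {L : Type*} [Preorder L] (M : Set L) : Set L := {x | ∃ m ∈ M, m ≤ x}

/-- `downSet M = {x | ∃ m ∈ M, x ≤ m}`. -/
def downSet {L : Type*} [Preorder L] (M : Set L) : Set L := {x | ∃ m ∈ M, x ≤ m}

/-- A finite duality `(A, B)`: finite antichains such that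
`x ∈ ↑A` iff `x ∉ ↓B`. -/
def FiniteDuality {L : Type*} [Preorder L] (A B : Set L) : Prop :=
  A.Finite ∧ B.Finite ∧ IsAntichain (· ≤ ·) A ∧ IsAntichain (· ≤ ·) B ∧
    ∀ x : L, (∃ a ∈ A, a ≤ x) ↔ ¬ ∃ b ∈ B, x ≤ b

/-- `(l, r)` is a duality pair if `¬ l ≤ x ↔ x ≤ r` for all `x`. -/
def DualityPair {L : Type*} [Preorder L] (l r : L) : Prop :=
  ∀ x : L, ¬ l ≤ x ↔ x ≤ r

/-- An element is connected (join-prime) if `a ≤ b ⊔ c` implies `a ≤ b` or `a ≤ c`. -/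
def ConnectedElt {L : Type*} [SemilatticeSup L] (a : L) : Prop :=
  ∀ b c : L, a ≤ b ⊔ c → a ≤ b ∨ a ≤ c

/-- `L` has finite connected decompositions: every element is the supremum of a
finite nonempty set of connected elements. -/
def HasFiniteConnectedDecompositions (L : Type*) [SemilatticeSup L] : Prop :=
  ∀ a : L, ∃ (F : Finset L) (h : F.Nonempty),
    (∀ c ∈ F, ConnectedElt c) ∧ F.sup' h id = a

/-- `c` is a connected component of `a`: `c` is connected and either `c = a` or
there is `b` with `a = b ⊔ c ≠ b`. -/
def IsConnComponent {L : Type*} [SemilatticeSup L] (c a : L) : Prop :=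
  ConnectedElt c ∧ (c = a ∨ ∃ b : L, a = b ⊔ c ∧ b ⊔ c ≠ b)

/-- `connComponents A` is the set of connected components of elements of `A`. -/
def connComponents {L : Type*} [SemilatticeSup L] (A : Set L) : Set L :=
  {c | ∃ a ∈ A, IsConnComponent c a}

/-- A quasitransversal of `A`: an antichain `M ⊆ A_Cn` with `A ⊆ ↑M`. -/
def IsQuasitransversal {L : Type*} [SemilatticeSup L] (M A : Set L) : Prop :=
  M ⊆ connComponents A ∧ IsAntichain (· ≤ ·) M ∧ A ⊆ upSet M

/-- A transversal of `A`: a quasitransversal maximal in the refinement order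
`M ⊴ N ↔ N ⊆ ↑M`. -/
def IsTransversal {L : Type*} [SemilatticeSup L] (M A : Set L) : Prop :=
  IsQuasitransversal M A ∧
    ∀ N : Set L, IsQuasitransversal N A → N ⊆ upSet M → N = M

/-- The set of weak left duals: elements of `A` for some finite duality `(A, B)`
with `B` nonempty. -/
def wld (L : Type*) [Preorder L] : Set L :=
  {a | ∃ A B : Set L, FiniteDuality A B ∧ B.Nonempty ∧ a ∈ A}

/-- The sparse incomparability axiom. -/
def SIA (L : Type*) [Preorder L] : Prop :=
  ∀ (x : L) (M U : Set L), M.Finite → U.Finite →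
    (insert x (upSet U)) ∩ wld L = ∅ →
    ∃ y : L, y ∉ wld L ∧ y ≤ x ∧ y ∉ upSet (insert x U) ∧
      ∀ m ∈ M, (y ≤ m ↔ x ≤ m)

/-- A connected element below a finite nonempty join is below one of the joinands. -/
theorem ConnectedElt.exists_le_of_le_sup' {L ι : Type*} [SemilatticeSup L] {c : L}
    (hc : ConnectedElt c) {s : Finset ι} (hs : s.Nonempty) (f : ι → L)
    (h : c ≤ s.sup' hs f) : ∃ i ∈ s, c ≤ f i := by
  induction hs using Finset.Nonempty.cons_induction with
  | singleton i => exact ⟨i, by simp, by simpa using h⟩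
  | cons i s hi hs ih =>
    rw [Finset.sup'_cons hs] at h
    rcases hc _ _ h with h | h
    · exact ⟨i, by simp, h⟩
    · obtain ⟨j, hj, hcj⟩ := ih h
      exact ⟨j, by simp [hj], hcj⟩

/-- A connected component of `x` is below `x`. -/
theorem IsConnComponent.le {L : Type*} [SemilatticeSup L] {c x : L}
    (h : IsConnComponent c x) : c ≤ x := by
  obtain ⟨-, rfl | ⟨b, rfl, -⟩⟩ := h
  · exact le_rfl
  · exact le_sup_right

/-- In a distributive lattice, a connected component of `x` is a connected component of
every element between it and `x`. -/
theorem IsConnComponent.of_le_of_le {L : Type*} [DistribLattice L] {c x y : L}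
    (h : IsConnComponent c x) (hcy : c ≤ y) (hyx : y ≤ x) : IsConnComponent c y := by
  obtain ⟨hc, rfl | ⟨b, rfl, hb⟩⟩ := h
  · exact ⟨hc, Or.inl (le_antisymm hcy hyx)⟩
  · refine ⟨hc, Or.inr ⟨y ⊓ b, ?_, fun h => hb ?_⟩⟩
    · rw [sup_inf_right, sup_eq_left.2 hcy, inf_eq_left.2 hyx]
    · exact sup_eq_left.2 ((sup_eq_left.1 h).trans inf_le_right)

/-- in a distributive lattice, a connected component of
`a = a₀ ⊔ ⋯ ⊔ aₙ` is a connected component of some `aᵢ`. -/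
theorem connComponent_of_sup {L : Type*} [DistribLattice L] (n : ℕ)
    (a : Fin (n + 1) → L) (c : L)
    (hc : IsConnComponent c (Finset.univ.sup' Finset.univ_nonempty a)) :
    ∃ i, IsConnComponent c (a i) := by
  obtain ⟨i, -, hi⟩ := hc.1.exists_le_of_le_sup' _ a hc.le
  exact ⟨i, hc.of_le_of_le hi (Finset.le_sup' a (Finset.mem_univ i))⟩
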